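/- Assume property (*). Then the torsion-free group G, which has cardinality ℵ_{ω+1}, does not admit an ℵ0-prebalanced chain: there is no ordinal θ and no increasing chain ⟨H_ν : ν ≤ θ⟩ of subgroups of G, continuous at limit stages (H_ρ = ⋃_{ν<ρ} H_ν for limit ρ ≤ θ), with H_0 = 0 and H_θ = G, such that each H_ν is pure and ℵ0-prebalanced in G and each successor quotient H_{ν+1}/H_ν has torsion-free rank at most 1. -/

import Mathlib

open Cardinal Ordinal Set

noncomputable section

/-- The order type of a set of ordinals: the unique ordinal order-isomorphic to it
under its natural ordering (it lives one universe up). -/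
def otype (A : Set Ordinal.{0}) : Ordinal.{1} :=
  Ordinal.type ((· < ·) : A → A → Prop)

/-- `C` is a club (closed unbounded) subset of the ordinal `l`. -/
def IsClubIn (C : Set Ordinal.{0}) (l : Ordinal.{0}) : Prop :=
  C ⊆ Set.Iio l ∧ (∀ a < l, ∃ b ∈ C, a ≤ b) ∧
    ∀ s : Set Ordinal.{0}, s ⊆ C → s.Nonempty → sSup s < l → sSup s ∈ C

/-- `S` is a stationary subset of the ordinal `l`. -/
def IsStationaryIn (S : Set Ordinal.{0}) (l : Ordinal.{0}) : Prop :=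
  S ⊆ Set.Iio l ∧ ∀ C : Set Ordinal.{0}, IsClubIn C l → (S ∩ C).Nonempty

/-- `γ` is the `ν`-th member of the set of ordinals `A`. -/
def nthMem (A : Set Ordinal.{0}) (ν : Ordinal.{1}) (γ : Ordinal.{0}) : Prop :=
  γ ∈ A ∧ otype (A ∩ Set.Iio γ) = ν

/-- The ambient group: the direct sum `(⊕_{α} ℚ) ⊕ (⊕_{β} ℚ)`, realized as
finitely supported functions from `Ordinal ⊕ Ordinal` to `ℚ`. -/
abbrev Vg : Type 1 := (Ordinal.{0} ⊕ Ordinal.{0}) →₀ ℚ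

/-- The distinguished basis element `x_α`. -/
def xg (α : Ordinal.{0}) : Vg := Finsupp.single (Sum.inl α) 1

/-- The distinguished basis element `y_β`. -/
def yg (β : Ordinal.{0}) : Vg := Finsupp.single (Sum.inr β) 1

/-- `h` is divisible by the natural number `m` inside the subgroup `H`. -/
def divIn (H : AddSubgroup Vg) (m : ℕ) (h : Vg) : Prop :=
  ∃ w ∈ H, h = m • w

/-- The set-theoretic data of the Magidor–Shelah construction, together with
property (*). `lam = ℵ_{ω+1}` and `mu = ℵ_ω` (as ordinals). -/
structure StarSystem where
  /-- the family `⟨f_α : α < λ⟩` of functions `ω → μ` -/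
  f : Ordinal.{0} → ℕ → Ordinal.{0}
  /-- the stationary set `S ⊆ λ` -/
  S : Set Ordinal.{0}
  /-- the countable ordinal `δ` -/
  δ : Ordinal.{1}
  /-- the sets `C_β` cofinal in `β` for `β ∈ S` -/
  C : Ordinal.{0} → Set Ordinal.{0}
  /-- the injective assignment `(ν, n) ↦ p^n_ν` of primes -/
  p : Ordinal.{1} → ℕ → ℕ
  f_lt : ∀ α < (Cardinal.aleph (Ordinal.omega0 + 1)).ord, ∀ n : ℕ,
    f α n < (Cardinal.aleph Ordinal.omega0).ord
  S_sub : S ⊆ Set.Iio (Cardinal.aleph (Ordinal.omega0 + 1)).ord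
  S_stat : IsStationaryIn S (Cardinal.aleph (Ordinal.omega0 + 1)).ord
  S_cof : ∀ β ∈ S, Ordinal.cof β = Cardinal.aleph 1
  δ_countable : δ < (Cardinal.aleph 1).ord
  δ_indec : ∀ a < δ, ∀ b < δ, a + b < δ
  C_sub : ∀ β ∈ S, C β ⊆ Set.Iio β
  C_cofinal : ∀ β ∈ S, sSup (C β) = β
  C_type : ∀ β ∈ S, otype (C β) = (Cardinal.aleph 1).ord
  D_type : ∀ β ∈ S, ∀ D ⊆ C β, sSup D = β →
    otype (⋃ α ∈ D, Set.range (f α)) = δ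
  E_inter : ∀ β ∈ S, ∀ γ ∈ S, β ≠ γ →
    otype ((⋃ α ∈ C β, Set.range (f α)) ∩ (⋃ α ∈ C γ, Set.range (f α))) < δ
  p_prime : ∀ ν < δ, ∀ n : ℕ, (p ν n).Prime
  p_inj : ∀ ν < δ, ∀ ν' < δ, ∀ n n' : ℕ, p ν n = p ν' n' → ν = ν' ∧ n = n'

namespace StarSystem

variable (𝒮 : StarSystem)

/-- `E_β = ⋃_{α ∈ C_β} F_α`, where `F_α` is the range of `f_α`. -/
def E (β : Ordinal.{0}) : Set Ordinal.{0} := ⋃ α ∈ 𝒮.C β, Set.range (𝒮.f α)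

/-- The generators of the group `G`: all `x_α` (`α < λ`), all `y_β` (`β ∈ S`),
and the elements `(1/p^n_ν)(y_β − x_α)` for `β ∈ S`, `α ∈ C_β`, `ν < δ`, `n < ω`
with `f_α(n)` the `ν`-th member of `E_β`. -/
def gens : Set Vg :=
  {v | ∃ α < (Cardinal.aleph (Ordinal.omega0 + 1)).ord, v = xg α} ∪
  {v | ∃ β ∈ 𝒮.S, v = yg β} ∪
  {v | ∃ β ∈ 𝒮.S, ∃ α ∈ 𝒮.C β, ∃ ν < 𝒮.δ, ∃ n : ℕ,
      nthMem (𝒮.E β) ν (𝒮.f α n) ∧ v = ((𝒮.p ν n : ℚ))⁻¹ • (yg β - xg α)}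

/-- The group `G`. -/
def G : AddSubgroup Vg := AddSubgroup.closure 𝒮.gens

/-- The subgroup `G_γ`, generated by those generators of `G` whose indices are
below `γ`. -/
def Gsub (γ : Ordinal.{0}) : AddSubgroup Vg :=
  AddSubgroup.closure
    ({v | ∃ α < (Cardinal.aleph (Ordinal.omega0 + 1)).ord, α < γ ∧ v = xg α} ∪
     {v | ∃ η ∈ 𝒮.S, η < γ ∧ v = yg η} ∪
     {v | ∃ η ∈ 𝒮.S, η < γ ∧ ∃ α ∈ 𝒮.C η, α < γ ∧ ∃ ν < 𝒮.δ, ∃ n : ℕ,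
        nthMem (𝒮.E η) ν (𝒮.f α n) ∧ v = ((𝒮.p ν n : ℚ))⁻¹ • (yg η - xg α)})

end StarSystem

end

noncomputable section

/-- The `q`-height of `a` in the subgroup `H`: the supremum (in `ℕ∞`) of the
`n` such that `q ^ n` divides `a` in `H`. -/
def pheight (H : AddSubgroup Vg) (q : ℕ) (a : Vg) : ℕ∞ :=
  sSup {N : ℕ∞ | ∃ n : ℕ, N = (n : ℕ∞) ∧ divIn H (q ^ n) a}

/-- `t(a) ≤ t(b_0) ∪ … ∪ t(b_e)` (heights computed in `H`): the set `Ω` of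
primes `q` with `h_q(a) > max_{i ≤ e} h_q(b_i)` is finite, and `h_q(a) < ∞`
for every `q ∈ Ω`. -/
def typeLe (H : AddSubgroup Vg) (a : Vg) (e : ℕ) (b : ℕ → Vg) : Prop :=
  {q : ℕ | q.Prime ∧
      (Finset.range (e + 1)).sup (fun i => pheight H q (b i)) < pheight H q a}.Finite ∧
  ∀ q ∈ {q : ℕ | q.Prime ∧
      (Finset.range (e + 1)).sup (fun i => pheight H q (b i)) < pheight H q a},
    pheight H q a ≠ ⊤

/-- `K` is `ℵ₀`-prebalanced in `H`: for every `h ∈ H ∖ K` there are countably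
many `g_0, g_1, … ∈ K` such that for every `g ∈ K` there are a positive integer
`l` and `e < ω` with `t(h − g) ≤ t(l·h − g_0) ∪ … ∪ t(l·h − g_e)`. -/
def Aleph0Prebalanced (K H : AddSubgroup Vg) : Prop :=
  ∀ h ∈ H, h ∉ K → ∃ g : ℕ → Vg, (∀ i, g i ∈ K) ∧
    ∀ z ∈ K, ∃ l : ℕ, 0 < l ∧ ∃ e : ℕ, typeLe H (h - z) e (fun i => l • h - g i)

end

/-- `K` is a pure subgroup of `H`: whenever `h ∈ K` is divisible by `n` in `H`,
it is divisible by `n` in `K`. -/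
def IsPureIn (K H : AddSubgroup Vg) : Prop :=
  ∀ h ∈ K, ∀ n : ℕ, divIn H n h → divIn K n h

open TensorProduct

section OT

theorem otype_mono {A B : Set Ordinal.{0}} (h : A ⊆ B) : otype A ≤ otype B :=
  Ordinal.type_le_iff'.2 ⟨⟨⟨Set.inclusion h, Set.inclusion_injective h⟩, Iff.rfl⟩⟩

theorem otype_typein (A : Set Ordinal.{0}) (c : A) :
    Ordinal.typein ((· < ·) : A → A → Prop) c = otype (A ∩ Set.Iio c.1) := by
  rw [← Ordinal.type_subrel]
  refine Ordinal.type_eq.2 ⟨⟨⟨fun x => ⟨x.1.1, x.1.2, x.2⟩, fun x => ⟨⟨x.1, x.2.1⟩, x.2.2⟩,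
    fun x => rfl, fun x => rfl⟩, Iff.rfl⟩⟩

theorem otype_inter_lt (A : Set Ordinal.{0}) {c : Ordinal.{0}} (hc : c ∈ A) :
    otype (A ∩ Set.Iio c) < otype A := by
  have := Ordinal.typein_lt_type ((· < ·) : A → A → Prop) ⟨c, hc⟩
  rwa [otype_typein] at this

theorem exists_nthMem (A : Set Ordinal.{0}) {o : Ordinal.{1}} (h : o < otype A) :
    ∃ c ∈ A, otype (A ∩ Set.Iio c) = o := by
  obtain ⟨c, hc⟩ := Ordinal.typein_surj ((· < ·) : A → A → Prop) h
  exact ⟨c.1, c.2, by rw [← hc]; exact (otype_typein A c).symm⟩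

theorem otype_split (A : Set Ordinal.{0}) (c : Ordinal.{0}) :
    otype A = otype (A ∩ Set.Iio c) + otype (A ∩ Set.Ici c) := by
  classical
  unfold otype
  rw [← Ordinal.type_sum_lex]
  refine (Ordinal.type_eq.2 ⟨⟨⟨Sum.elim (fun x => (⟨x.1, x.2.1⟩ : A)) (fun x => ⟨x.1, x.2.1⟩),
    fun x => if h : x.1 < c then Sum.inl ⟨x.1, x.2, h⟩ else Sum.inr ⟨x.1, x.2, not_lt.1 h⟩,
    ?_, ?_⟩, ?_⟩⟩).symm
  · rintro (⟨x, hx, h⟩ | ⟨x, hx, h⟩)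
    · have h' : x < c := h
      simp [h']
    · have h' : ¬ x < c := not_lt.2 h
      exact dif_neg h'
  · rintro ⟨x, hx⟩
    by_cases h : x < c <;> simp [h]
  · rintro (⟨x, hx, h⟩ | ⟨x, hx, h⟩) (⟨y, hy, h'⟩ | ⟨y, hy, h'⟩)
    · rw [Sum.lex_inl_inl]; exact Iff.rfl
    · simpa using lt_of_lt_of_le h h'
    · simpa using le_trans (le_of_lt h') h
    · rw [Sum.lex_inr_inr]; exact Iff.rfl

theorem otype_empty : otype ∅ = 0 := by
  unfold otype
  exact Ordinal.type_eq_zero_iff_isEmpty.2 inferInstance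

theorem otype_eq_zero {A : Set Ordinal.{0}} (h : otype A = 0) : A = ∅ := by
  unfold otype at h
  have := Ordinal.type_eq_zero_iff_isEmpty.1 h
  exact Set.isEmpty_coe_sort.1 this

theorem otype_singleton (c : Ordinal.{0}) : otype {c} = 1 := by
  unfold otype
  exact Ordinal.type_eq_one_of_unique _

theorem otype_union_aux (w : Ordinal.{1})
    (P : ∀ A B : Set Ordinal.{0}, otype A < w → otype B < w → otype (A ∪ B) < w) :
    ∀ n : ℕ, ∀ a b : ℕ, a + b = n → ∀ A B : Set Ordinal.{0},
      otype A < w * a → otype B < w * b → otype (A ∪ B) ≤ w * n := by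
  have key : ∀ (A : Set Ordinal.{0}) (c : Ordinal.{0}) (a : ℕ), otype A < w * (a + 1 : ℕ) →
      w ≤ otype (A ∩ Set.Iio c) → otype (A ∩ Set.Ici c) < w * a := by
    intro A c a hA hw
    have h1 : w + otype (A ∩ Set.Ici c) < w + w * a := by
      calc w + otype (A ∩ Set.Ici c) ≤ otype A := by
            rw [otype_split A c]; exact add_le_add_left hw _
        _ < w * (a + 1 : ℕ) := hA
        _ = w + w * a := by
            have : ((a + 1 : ℕ) : Ordinal.{1}) = 1 + a := by
              rw [add_comm a 1]; push_cast; rfl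
            rw [this, mul_add, mul_one]
    exact lt_of_add_lt_add_left h1
  intro n
  induction n with
  | zero =>
    intro a b hab A B hA hB
    have : a = 0 := by omega
    subst this
    simp at hA
  | succ n ih =>
    intro a b hab A B hA hB
    have hn : w * (n + 1 : ℕ) = w + w * n := by
      have : ((n + 1 : ℕ) : Ordinal.{1}) = 1 + n := by
        rw [add_comm n 1]; push_cast; rfl
      rw [this, mul_add, mul_one]
    by_cases hX : otype (A ∪ B) ≤ w
    · rw [hn]; exact hX.trans (by simp)
    obtain ⟨c, hc, hcw⟩ := exists_nthMem _ (not_le.1 hX)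
    rw [hn, otype_split _ c, hcw]
    refine add_le_add_right ?_ w
    rw [Set.union_inter_distrib_right] at hcw ⊢
    obtain _ | a := a
    · simp at hA
    obtain _ | b := b
    · simp at hB
    by_cases h1 : otype (A ∩ Set.Iio c) < w
    · by_cases h2 : otype (B ∩ Set.Iio c) < w
      · exact absurd (P _ _ h1 h2) (by rw [hcw]; exact lt_irrefl _)
      · exact ih (a + 1) b (by omega) _ _
          ((otype_mono Set.inter_subset_left).trans_lt hA) (key B c b hB (not_lt.1 h2))
    · exact ih a (b + 1) (by omega) _ _ (key A c a hA (not_lt.1 h1))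
          ((otype_mono Set.inter_subset_left).trans_lt hB)

theorem otype_union_opow (κ : Ordinal.{1}) : ∀ A B : Set Ordinal.{0},
    otype A < ω ^ κ → otype B < ω ^ κ → otype (A ∪ B) < ω ^ κ := by
  induction κ using Ordinal.limitRecOn with
  | zero =>
    intro A B hA hB
    rw [opow_zero, Order.lt_one_iff] at *
    rw [otype_eq_zero hA, otype_eq_zero hB, Set.union_empty, otype_empty]
  | add_one κ ih =>
    intro A B hA hB
    rw [← Order.succ_eq_add_one] at *
    obtain ⟨a, ha⟩ := lt_omega0_opow_succ.1 hA
    obtain ⟨b, hb⟩ := lt_omega0_opow_succ.1 hB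
    refine lt_omega0_opow_succ.2 ⟨a + b + 1, ?_⟩
    refine (otype_union_aux _ ih _ a b rfl A B ha hb).trans_lt ?_
    have : (0 : Ordinal.{1}) < ω ^ κ := opow_pos _ omega0_pos
    exact (mul_lt_mul_iff_right₀ this).2 (by exact_mod_cast Nat.lt_succ_self _)
  | limit κ hκ ih =>
    intro A B hA hB
    obtain ⟨a, ha, ha'⟩ := (lt_opow_of_isSuccLimit omega0_ne_zero hκ).1 hA
    obtain ⟨b, hb, hb'⟩ := (lt_opow_of_isSuccLimit omega0_ne_zero hκ).1 hB
    refine (lt_opow_of_isSuccLimit omega0_ne_zero hκ).2 ⟨max a b, max_lt ha hb, ?_⟩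
    refine ih _ (max_lt ha hb) _ _ (ha'.trans_le ?_) (hb'.trans_le ?_)
    · exact opow_le_opow_right omega0_pos (le_max_left _ _)
    · exact opow_le_opow_right omega0_pos (le_max_right _ _)

theorem otype_union {δ : Ordinal.{1}} (hδ : ∀ a < δ, ∀ b < δ, a + b < δ) (A B : Set Ordinal.{0})
    (hA : otype A < δ) (hB : otype B < δ) : otype (A ∪ B) < δ := by
  have h : IsPrincipal (fun x1 x2 => x1 + x2) δ := fun a b ha hb => hδ a ha b hb
  rcases isPrincipal_add_iff_zero_or_omega0_opow.1 h with h | ⟨κ, hκ⟩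
  · subst h; simp at hA
  · simp only at hκ
    subst hκ
    exact otype_union_opow κ A B hA hB

theorem otype_biUnion {δ : Ordinal.{1}} (hδ : ∀ a < δ, ∀ b < δ, a + b < δ) (h0 : 0 < δ)
    {ι : Type*} (s : Finset ι) (A : ι → Set Ordinal.{0}) (hA : ∀ i ∈ s, otype (A i) < δ) :
    otype (⋃ i ∈ s, A i) < δ := by
  classical
  induction s using Finset.induction_on with
  | empty => simpa [otype_empty] using h0
  | insert i s hi ih =>
    rw [Finset.set_biUnion_insert]
    exact otype_union hδ _ _ (hA i (by simp)) (ih fun j hj => hA j (by simp [hj]))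

theorem otype_countable {A : Set Ordinal.{0}} (h : otype A < (Cardinal.aleph 1).ord) :
    A.Countable := by
  have h1 : (otype A).card < Cardinal.aleph 1 := Cardinal.lt_ord.1 h
  unfold otype at h1
  rw [Ordinal.card_type] at h1
  rw [← Cardinal.le_aleph0_iff_set_countable]
  rw [← Cardinal.succ_aleph0] at h1
  exact Order.lt_succ_iff.1 h1

end OT
section Chain

theorem divIn_sub {G : AddSubgroup Vg} {m : ℕ} {a b : Vg} (ha : divIn G m a) (hb : divIn G m b) :
    divIn G m (a - b) := by
  obtain ⟨u, hu, rfl⟩ := ha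
  obtain ⟨v, hv, rfl⟩ := hb
  exact ⟨u - v, G.sub_mem hu hv, (smul_sub _ _ _).symm⟩

theorem divIn_add {G : AddSubgroup Vg} {m : ℕ} {a b : Vg} (ha : divIn G m a) (hb : divIn G m b) :
    divIn G m (a + b) := by
  obtain ⟨u, hu, rfl⟩ := ha
  obtain ⟨v, hv, rfl⟩ := hb
  exact ⟨u + v, G.add_mem hu hv, (smul_add _ _ _).symm⟩

theorem divIn_smul {G : AddSubgroup Vg} {m : ℕ} {a : Vg} (k : ℕ) (ha : divIn G m a) :
    divIn G m (k • a) := by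
  obtain ⟨u, hu, rfl⟩ := ha
  exact ⟨k • u, G.nsmul_mem hu k, smul_comm _ _ _⟩

theorem divIn_of_typeLe {G : AddSubgroup Vg} {a : Vg} {e : ℕ} {b : ℕ → Vg}
    (h : typeLe G a e b) : ∃ P : Finset ℕ, ∀ p : ℕ, p.Prime → p ∉ P → divIn G p a →
      ∃ i < e + 1, divIn G p (b i) := by
  obtain ⟨hf, -⟩ := h
  refine ⟨hf.toFinset, fun p hp hpP hd => ?_⟩
  have h1 : (1 : ℕ∞) ≤ pheight G p a :=
    le_sSup ⟨1, by simp, by simpa using hd⟩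
  have h2 : ¬ ((Finset.range (e + 1)).sup (fun i => pheight G p (b i)) < pheight G p a) := by
    intro h; exact hpP (by simpa using ⟨hp, h⟩)
  have h3 : 0 < (Finset.range (e + 1)).sup (fun i => pheight G p (b i)) :=
    lt_of_lt_of_le (by norm_num) (h1.trans (not_lt.1 h2))
  obtain ⟨i, hi, h4⟩ := Finset.lt_sup_iff.1 h3
  refine ⟨i, Finset.mem_range.1 hi, ?_⟩
  obtain ⟨N, ⟨n, rfl, w, hw, hn⟩, h5⟩ := lt_sSup_iff.1 h4
  obtain _ | n := n
  · simp at h5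
  · exact ⟨p ^ n • w, G.nsmul_mem hw _, by rw [hn, smul_smul, pow_succ, mul_comm]⟩

/-- Finitely many elements `l • v - z` with `z ∈ Z` capture almost all primes satisfying `Q`. -/
def Cov (G : AddSubgroup Vg) (v : Vg) (Q : ℕ → Prop) (Z : Set Vg) : Prop :=
  ∃ F : Finset (ℕ × Vg), (∀ x ∈ F, 0 < x.1 ∧ x.2 ∈ Z) ∧ ∃ P : Finset ℕ,
    ∀ p : ℕ, p.Prime → p ∉ P → Q p → ∃ x ∈ F, divIn G p (x.1 • v - x.2)

theorem Cov.mono {G : AddSubgroup Vg} {v : Vg} {Q Q' : ℕ → Prop} {Z Z' : Set Vg}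
    (h : Cov G v Q Z) (hQ : ∀ p, Q' p → Q p) (hZ : Z ⊆ Z') : Cov G v Q' Z' := by
  obtain ⟨F, hF, P, hP⟩ := h
  exact ⟨F, fun x hx => ⟨(hF x hx).1, hZ (hF x hx).2⟩, P, fun p hp hpP hq => hP p hp hpP (hQ p hq)⟩

theorem cov_self {G : AddSubgroup Vg} {v z : Vg} {l : ℕ} (hl : 0 < l) {Z : Set Vg} (hz : z ∈ Z) :
    Cov G v (fun p => divIn G p (l • v - z)) Z :=
  ⟨{(l, z)}, by simp [hl, hz], ∅, fun p _ _ h => ⟨(l, z), by simp, h⟩⟩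

theorem Cov.trans {G : AddSubgroup Vg} {v : Vg} {Q : ℕ → Prop} {Z Z' : Set Vg}
    (h : Cov G v Q Z)
    (h' : ∀ l : ℕ, 0 < l → ∀ z ∈ Z, Cov G v (fun p => Q p ∧ divIn G p (l • v - z)) Z') :
    Cov G v Q Z' := by
  classical
  obtain ⟨F, hF, P, hP⟩ := h
  have h2 : ∀ x : ℕ × Vg, x ∈ F → Cov G v (fun p => Q p ∧ divIn G p (x.1 • v - x.2)) Z' :=
    fun x hx => h' _ (hF x hx).1 _ (hF x hx).2
  choose! F' hF' P' hP' using h2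
  refine ⟨F.biUnion F', ?_, P ∪ F.biUnion P', ?_⟩
  · intro x hx
    obtain ⟨y, hy, hx⟩ := Finset.mem_biUnion.1 hx
    exact hF' y hy x hx
  · intro p hp hpP hq
    rw [Finset.mem_union, Finset.mem_biUnion] at hpP
    push Not at hpP
    obtain ⟨x, hx, hd⟩ := hP p hp hpP.1 hq
    obtain ⟨y, hy, hd'⟩ := hP' x hx p hp (hpP.2 x hx) ⟨hq, hd⟩
    exact ⟨y, Finset.mem_biUnion.2 ⟨x, hx, hy⟩, hd'⟩

/-- `K` is prebalanced at `v` in the weak sense that matters to us. -/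
def GoodFor (G K : AddSubgroup Vg) (v : Vg) : Prop :=
  ∃ A : Set Vg, A.Countable ∧ A ⊆ K ∧ ∀ z ∈ K, ∀ l : ℕ, 0 < l →
    Cov G v (fun p => divIn G p (l • v - z)) A

theorem goodFor_of_mem {G K : AddSubgroup Vg} {v : Vg} (hv : v ∈ K) : GoodFor G K v := by
  refine ⟨{v}, by simp, by simpa using hv, fun z hz l hl => ?_⟩
  refine ⟨{(1, v)}, by simp, ∅, fun p hp _ _ => ⟨(1, v), by simp, 0, G.zero_mem, by simp⟩⟩

theorem goodFor_of_mul {G K : AddSubgroup Vg} {v k : Vg} {m : ℕ} (hm : 0 < m) (hk : k ∈ K)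
    (h : GoodFor G K (m • v - k)) : GoodFor G K v := by
  classical
  obtain ⟨A, hA, hAK, h⟩ := h
  refine ⟨⋃ l : ℕ, (fun a => l • k + a) '' A, Set.countable_iUnion fun l => hA.image _, ?_, ?_⟩
  · intro x hx
    obtain ⟨l, a, ha, rfl⟩ := Set.mem_iUnion.1 hx
    exact K.add_mem (K.nsmul_mem hk l) (hAK ha)
  · intro z hz l hl
    obtain ⟨F, hF, P, hP⟩ := h (m • z - l • k) (K.sub_mem (K.nsmul_mem hz m) (K.nsmul_mem hk l)) l hl
    refine ⟨F.image fun x => (x.1 * m, x.1 • k + x.2), ?_, P, ?_⟩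
    · intro x hx
      obtain ⟨y, hy, rfl⟩ := Finset.mem_image.1 hx
      exact ⟨Nat.mul_pos (hF y hy).1 hm, Set.mem_iUnion.2 ⟨y.1, y.2, (hF y hy).2, rfl⟩⟩
    · intro p hp hpP hd
      have hd2 : divIn G p (l • (m • v - k) - (m • z - l • k)) := by
        convert divIn_smul m hd using 1
        module
      obtain ⟨y, hy, hd3⟩ := hP p hp hpP hd2
      refine ⟨_, Finset.mem_image.2 ⟨y, hy, rfl⟩, ?_⟩
      convert hd3 using 1
      module

theorem rank_dep {A B : AddSubgroup Vg} (hAB : A ≤ B)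
    (hr : Module.rank ℚ (ℚ ⊗[ℤ] (↥B ⧸ A.addSubgroupOf B)) ≤ 1) {v k : Vg}
    (hv : v ∈ B) (hk : k ∈ B) : ∃ a b : ℤ, (a ≠ 0 ∨ b ≠ 0) ∧ a • v + b • k ∈ A := by
  have h1 : Module.rank ℤ (↥B ⧸ A.addSubgroupOf B) ≤ 1 := by
    rw [← IsLocalizedModule.rank_eq (nonZeroDivisors ℤ) le_rfl
      (TensorProduct.mk ℤ ℚ (↥B ⧸ A.addSubgroupOf B) 1),
      ← IsFractionRing.rank_right_eq ℤ ℚ]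
    exact hr
  by_contra hcon
  push Not at hcon
  have hli : LinearIndependent ℤ ![(QuotientAddGroup.mk ⟨v, hv⟩ : ↥B ⧸ A.addSubgroupOf B),
      QuotientAddGroup.mk ⟨k, hk⟩] := by
    rw [LinearIndependent.pair_iff]
    intro s t hst
    rw [← QuotientAddGroup.mk_zsmul, ← QuotientAddGroup.mk_zsmul, ← QuotientAddGroup.mk_add,
      QuotientAddGroup.eq_zero_iff] at hst
    by_contra hne
    refine hcon s t ?_ ?_
    · by_cases hs : s = 0
      · right; intro ht; exact hne ⟨hs, ht⟩
      · left; exact hs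
    · simpa [AddSubgroup.mem_addSubgroupOf] using hst
  have h2 := hli.cardinal_lift_le_rank
  have h3 := h2.trans (Cardinal.lift_le.2 h1)
  simp at h3

/-- From purity and rank one: a positive multiple of `v` is in `A` modulo multiples of `k`. -/
theorem rank_dep' {G A B : AddSubgroup Vg} (hAB : A ≤ B) (hBG : B ≤ G) (hp : IsPureIn A G)
    (hr : Module.rank ℚ (ℚ ⊗[ℤ] (↥B ⧸ A.addSubgroupOf B)) ≤ 1) {v k : Vg}
    (hv : v ∈ B) (hk : k ∈ B) (hkA : k ∉ A) :
    ∃ a : ℕ, 0 < a ∧ ∃ b : ℤ, a • v - b • k ∈ A := by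
  have hpure : ∀ n : ℕ, 0 < n → n • k ∉ A := by
    intro n hn hmem
    obtain ⟨w, hw, he⟩ := hp _ hmem n ⟨k, hBG hk, rfl⟩
    have : k = w := smul_right_injective Vg hn.ne' he
    exact hkA (this ▸ hw)
  obtain ⟨a, b, hne, hab⟩ := rank_dep hAB hr hv hk
  have ha : a ≠ 0 := by
    rintro rfl
    have hb : b ≠ 0 := by simpa using hne
    rw [zero_smul, zero_add] at hab
    refine hpure b.natAbs (Int.natAbs_pos.2 hb) ?_
    rcases Int.natAbs_eq b with h | h
    · rwa [h, natCast_zsmul] at hab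
    · rw [h, neg_smul, natCast_zsmul] at hab; simpa only [neg_neg] using A.neg_mem hab
  refine ⟨a.natAbs, Int.natAbs_pos.2 ha, ?_⟩
  rcases Int.natAbs_eq a with h | h
  · refine ⟨-b, ?_⟩
    rw [h, natCast_zsmul] at hab
    rwa [neg_smul, sub_neg_eq_add]
  · refine ⟨b, ?_⟩
    rw [h, neg_smul, natCast_zsmul] at hab
    convert A.neg_mem hab using 1
    abel

theorem chain_good (G K : AddSubgroup Vg) (θ : Ordinal.{1}) (H : Ordinal.{1} → AddSubgroup Vg)
    (hG : ∀ ν ≤ θ, H ν ≤ G)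
    (hmono : ∀ ν₁ : Ordinal.{1}, ∀ ν₂ ≤ θ, ν₁ ≤ ν₂ → H ν₁ ≤ H ν₂)
    (hlim : ∀ ρ ≤ θ, Order.IsSuccLimit ρ → ∀ v : Vg, (v ∈ H ρ ↔ ∃ ν < ρ, v ∈ H ν))
    (h0 : H 0 = ⊥)
    (hpb : ∀ ν ≤ θ, IsPureIn (H ν) G ∧ Aleph0Prebalanced (H ν) G)
    (hrk : ∀ ν < θ, Module.rank ℚ
          (ℚ ⊗[ℤ] (↥(H (ν + 1)) ⧸ (H ν).addSubgroupOf (H (ν + 1)))) ≤ 1)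
    (rk : Vg → Ordinal.{1}) (g : Vg → ℕ → Vg)
    (hK1 : ∀ z ∈ K, z ≠ 0 → rk z < θ ∧ z ∈ H (rk z + 1) ∧ z ∉ H (rk z) ∧
      (∀ i, g z i ∈ H (rk z)) ∧ (∀ i, g z i ∈ K) ∧
      ∀ w ∈ H (rk z), ∃ l : ℕ, 0 < l ∧ ∃ e : ℕ, typeLe G (z - w) e (fun i => l • z - g z i)) :
    ∀ ν ≤ θ, ∀ v ∈ H ν, GoodFor G K v := by
  classical
  intro ν
  induction ν using Ordinal.limitRecOn with
  | zero =>
    intro _ v hv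
    rw [h0, AddSubgroup.mem_bot] at hv
    subst hv
    exact goodFor_of_mem K.zero_mem
  | limit ρ hρ ih =>
    intro hle v hv
    obtain ⟨ν, hν, hv⟩ := (hlim ρ hle hρ v).1 hv
    exact ih ν hν (hν.le.trans hle) v hv
  | add_one μ ih =>
    intro hle v hv
    have hμθ : μ < θ := (Order.lt_add_one_iff.2 le_rfl).trans_le hle
    replace ih := ih hμθ.le
    by_cases hvμ : v ∈ H μ
    · exact ih v hvμ
    by_cases hex : ∃ k ∈ K, k ∈ H (μ + 1) ∧ k ∉ H μ
    · obtain ⟨k, hkK, hk1, hk2⟩ := hex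
      obtain ⟨a, ha, b, hab⟩ := rank_dep' (hmono _ _ hle (by simp)) (hG _ hle)
        (hpb μ hμθ.le).1 (hrk μ hμθ) hv hk1 hk2
      exact goodFor_of_mul ha (K.zsmul_mem hkK b) (ih _ hab)
    push Not at hex
    -- the inner induction
    have inner : ∀ ρ : Ordinal.{1}, ∀ z ∈ K, z ≠ 0 → rk z = ρ → ∀ l : ℕ, 0 < l →
        Cov G v (fun p => divIn G p (l • v - z)) {z | z ∈ K ∧ z ∈ H μ} := by
      intro ρ
      induction ρ using WellFoundedLT.induction with
      | ind ρ ihρ =>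
      intro z hzK hz0 hzρ l hl
      subst hzρ
      by_cases hzμ : z ∈ H μ
      · exact cov_self hl ⟨hzK, hzμ⟩
      obtain ⟨hρθ, hz1, hz2, hg1, hg2, hg3⟩ := hK1 z hzK hz0
      have hμρ : μ + 1 ≤ rk z := by
        rw [Order.add_one_le_iff]
        refine lt_of_le_of_ne ?_ ?_
        · by_contra hcon
          exact hzμ (hmono _ _ hμθ.le (Order.add_one_le_of_lt (not_le.1 hcon)) hz1)
        · intro heq
          rw [← heq] at hz1 hz2
          exact hz2 (hex z hzK hz1)
      obtain ⟨l', hl', e, hty⟩ := hg3 (l • v) ((H (rk z)).nsmul_mem (hmono _ _ hρθ.le hμρ hv) l)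
      have hc : Cov G v (fun p => divIn G p (l • v - z)) (Set.range (g z)) := by
        obtain ⟨P, hP⟩ := divIn_of_typeLe hty
        refine ⟨(Finset.range (e + 1)).image fun i => (l' * l, g z i), ?_, P, ?_⟩
        · intro x hx
          obtain ⟨i, -, rfl⟩ := Finset.mem_image.1 hx
          exact ⟨Nat.mul_pos hl' hl, i, rfl⟩
        · intro p hp hpP hd
          have hd' : divIn G p (z - l • v) := by
            obtain ⟨w, hw, he⟩ := hd
            exact ⟨-w, G.neg_mem hw, by rw [smul_neg, ← he]; abel⟩
          obtain ⟨i, hi, hd2⟩ := hP p hp hpP hd'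
          refine ⟨_, Finset.mem_image.2 ⟨i, Finset.mem_range.2 hi, rfl⟩, ?_⟩
          convert divIn_add (divIn_smul l' hd) hd2 using 1
          module
      refine hc.trans ?_
      rintro l'' hl'' _ ⟨i, rfl⟩
      refine Cov.mono (Q := fun p => divIn G p (l'' • v - g z i)) ?_ (fun p h => h.2) le_rfl
      by_cases hgi : g z i = 0
      · exact cov_self hl'' ⟨hg2 i, by rw [hgi]; exact (H μ).zero_mem⟩
      · refine ihρ (rk (g z i)) ?_ (g z i) (hg2 i) hgi rfl l'' hl''
        obtain ⟨hρθ', -, hz2', -⟩ := hK1 _ (hg2 i) hgi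
        by_contra hcon
        exact hz2' (hmono _ _ hρθ'.le (not_lt.1 hcon) (hg1 i))
    have inner' : ∀ z ∈ K, ∀ l : ℕ, 0 < l →
        Cov G v (fun p => divIn G p (l • v - z)) {z | z ∈ K ∧ z ∈ H μ} := by
      intro z hz l hl
      by_cases hz0 : z = 0
      · exact cov_self hl ⟨hz, by rw [hz0]; exact (H μ).zero_mem⟩
      · exact inner _ z hz hz0 rfl l hl
    have hvG : v ∈ G := hG _ hle hv
    have hpr : ∀ l : ℕ, 0 < l → ∃ g : ℕ → Vg, (∀ i, g i ∈ H μ) ∧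
        ∀ z ∈ H μ, ∃ l' : ℕ, 0 < l' ∧ ∃ e : ℕ,
          typeLe G (l • v - z) e (fun i => l' • (l • v) - g i) := by
      intro l hl
      refine (hpb μ hμθ.le).2 (l • v) (G.nsmul_mem hvG l) ?_
      intro hmem
      obtain ⟨w, hw, he⟩ := (hpb μ hμθ.le).1 _ hmem l ⟨v, hvG, rfl⟩
      have : v = w := smul_right_injective Vg hl.ne' he
      exact hvμ (this ▸ hw)
    choose! γ hγ1 hγ2 using hpr
    have hA : ∀ l : ℕ, 0 < l → ∀ i, GoodFor G K (γ l i) := fun l hl i => ih _ (hγ1 l hl i)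
    choose! A hA1 hA2 hA3 using hA
    refine ⟨⋃ (l : ℕ) (i : ℕ) (_ : 0 < l), A l i, ?_, ?_, ?_⟩
    · refine Set.countable_iUnion fun l => Set.countable_iUnion fun i => Set.countable_iUnion fun h => hA1 l h i
    · intro x hx
      simp only [Set.mem_iUnion] at hx
      obtain ⟨l, i, h, hx⟩ := hx
      exact hA2 l h i hx
    intro z hz l hl
    refine (inner' z hz l hl).trans ?_
    rintro l0 hl0 z0 ⟨hz0K, hz0μ⟩
    refine Cov.mono (Q := fun p => divIn G p (l0 • v - z0)) ?_ (fun p h => h.2) le_rfl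
    obtain ⟨l1, hl1, e, hty⟩ := hγ2 l0 hl0 z0 hz0μ
    have hc : Cov G v (fun p => divIn G p (l0 • v - z0)) (Set.range (γ l0)) := by
      obtain ⟨P, hP⟩ := divIn_of_typeLe hty
      refine ⟨(Finset.range (e + 1)).image fun i => (l1 * l0, γ l0 i), ?_, P, ?_⟩
      · intro x hx
        obtain ⟨i, -, rfl⟩ := Finset.mem_image.1 hx
        exact ⟨Nat.mul_pos hl1 hl0, i, rfl⟩
      · intro p hp hpP hd
        obtain ⟨i, hi, hd2⟩ := hP p hp hpP hd
        refine ⟨_, Finset.mem_image.2 ⟨i, Finset.mem_range.2 hi, rfl⟩, ?_⟩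
        convert hd2 using 1
        module
    refine hc.trans ?_
    rintro l2 hl2 _ ⟨i, rfl⟩
    obtain ⟨F, hF, P, hP⟩ := hA3 l0 hl0 i (l2 • z0) (K.nsmul_mem hz0K l2) l0 hl0
    refine ⟨F.image fun x => (x.1 * l2, x.2), ?_, P, ?_⟩
    · intro x hx
      obtain ⟨y, hy, rfl⟩ := Finset.mem_image.1 hx
      refine ⟨Nat.mul_pos (hF y hy).1 hl2, ?_⟩
      simp only [Set.mem_iUnion]
      exact ⟨l0, i, hl0, (hF y hy).2⟩
    · rintro p hp hpP ⟨hd1, hd2⟩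
      have hd3 : divIn G p (l0 • γ l0 i - l2 • z0) := by
        convert divIn_sub (divIn_smul l2 hd1) (divIn_smul l0 hd2) using 1
        module
      obtain ⟨y, hy, hd4⟩ := hP p hp hpP hd3
      refine ⟨_, Finset.mem_image.2 ⟨y, hy, rfl⟩, ?_⟩
      convert divIn_add (divIn_smul y.1 hd2) hd4 using 1
      module

end Chain
section Star

theorem nthMem_unique {A : Set Ordinal.{0}} {ν : Ordinal.{1}} {c d : Ordinal.{0}}
    (hc : nthMem A ν c) (hd : nthMem A ν d) : c = d := by
  have key : ∀ c d : Ordinal.{0}, nthMem A ν c → nthMem A ν d → ¬ c < d := by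
    intro c d hc hd hlt
    have h := otype_inter_lt (A ∩ Set.Iio d) (c := c) ⟨hc.1, hlt⟩
    have h2 : A ∩ Set.Iio d ∩ Set.Iio c = A ∩ Set.Iio c := by
      ext x
      simp only [Set.mem_inter_iff, Set.mem_Iio]
      exact ⟨fun h => ⟨h.1.1, h.2⟩, fun h => ⟨⟨h.1, h.2.trans hlt⟩, h.2⟩⟩
    rw [h2, hc.2, hd.2] at h
    exact lt_irrefl _ h
  exact le_antisymm (not_lt.1 (key d c hd hc)) (not_lt.1 (key c d hc hd))

theorem div_cases (𝒮 : StarSystem) {β : Ordinal.{0}} (hβ : β ∈ 𝒮.S) {ν : Ordinal.{1}}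
    (hν : ν < 𝒮.δ) {n : ℕ} {γ : Ordinal.{0}} (hγ : nthMem (𝒮.E β) ν γ) {l : ℕ} {g : Vg}
    (hl : ¬ 𝒮.p ν n ∣ l) (hg : g (Sum.inr β) = 0)
    (hd : divIn 𝒮.G (𝒮.p ν n) (l • yg β - g)) :
    (∃ α, g (Sum.inl α) ≠ 0 ∧ 𝒮.f α n = γ ∧ ∃ β' ∈ 𝒮.S, α ∈ 𝒮.C β') ∨
    (∃ β' ∈ 𝒮.S, g (Sum.inr β') ≠ 0 ∧ nthMem (𝒮.E β') ν γ) := by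
  classical
  by_contra hcon
  push Not at hcon
  obtain ⟨hc1, hc2⟩ := hcon
  have hp := 𝒮.p_prime ν hν n
  have : Fact (𝒮.p ν n).Prime := ⟨hp⟩
  let T : Set (Ordinal.{0} ⊕ Ordinal.{0}) :=
    {i | (∃ α, i = Sum.inl α ∧ 𝒮.f α n = γ ∧ ∃ β' ∈ 𝒮.S, α ∈ 𝒮.C β') ∨
      (∃ β' ∈ 𝒮.S, i = Sum.inr β' ∧ nthMem (𝒮.E β') ν γ)}
  have hTl : ∀ α, Sum.inl α ∈ T ↔ (𝒮.f α n = γ ∧ ∃ β' ∈ 𝒮.S, α ∈ 𝒮.C β') := by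
    intro α; simp [T]
  have hTr : ∀ β', Sum.inr β' ∈ T ↔ (β' ∈ 𝒮.S ∧ nthMem (𝒮.E β') ν γ) := by
    intro α; simp [T]
  let c : Ordinal.{0} ⊕ Ordinal.{0} → ℚ := fun i => if i ∈ T then 1 else 0
  let φ : Vg →ₗ[ℚ] ℚ := Finsupp.linearCombination ℚ c
  have hφx : ∀ α, φ (xg α) = c (Sum.inl α) := by
    intro α; simp [φ, xg, Finsupp.linearCombination_single]
  have hφy : ∀ α, φ (yg α) = c (Sum.inr α) := by
    intro α; simp [φ, yg, Finsupp.linearCombination_single]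
  have hcn : ∀ i, padicNorm (𝒮.p ν n) (c i) ≤ 1 := by
    intro i
    by_cases h : i ∈ T <;> simp [c, h]
  have hintegral : ∀ w ∈ 𝒮.G, padicNorm (𝒮.p ν n) (φ w) ≤ 1 := by
    intro w hw
    induction hw using AddSubgroup.closure_induction with
    | mem w hw =>
      rcases hw with (⟨α, -, rfl⟩ | ⟨β', -, rfl⟩) | ⟨β', hβ', α, hα, ν', hν', n', hnth, rfl⟩
      · rw [hφx]; exact hcn _
      · rw [hφy]; exact hcn _
      · rw [map_smul, map_sub, hφx, hφy, _root_.smul_eq_mul]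
        by_cases hpp : 𝒮.p ν' n' = 𝒮.p ν n
        · obtain ⟨rfl, rfl⟩ := 𝒮.p_inj ν' hν' ν hν n' n hpp
          have hiff : Sum.inr β' ∈ T ↔ Sum.inl α ∈ T := by
            rw [hTl, hTr]
            constructor
            · rintro ⟨-, h⟩
              exact ⟨nthMem_unique hnth h, β', hβ', hα⟩
            · rintro ⟨h, -⟩
              exact ⟨hβ', h ▸ hnth⟩
          have : c (Sum.inr β') = c (Sum.inl α) := by simp [c, hiff]
          rw [this]; simp
        · rw [padicNorm.mul]
          have h1 : padicNorm (𝒮.p ν n) ((𝒮.p ν' n' : ℚ))⁻¹ = 1 := by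
            have hq : padicNorm (𝒮.p ν n) (𝒮.p ν' n' : ℚ) = 1 := by
              rw [padicNorm.nat_eq_one_iff]
              intro hdvd
              exact hpp ((Nat.prime_dvd_prime_iff_eq hp (𝒮.p_prime ν' hν' n')).1 hdvd).symm
            have := padicNorm.div (p := 𝒮.p ν n) 1 (𝒮.p ν' n' : ℚ)
            rw [hq] at this
            simpa using this
          rw [h1, one_mul]
          exact padicNorm.sub.trans (max_le (hcn _) (hcn _))
    | zero => simp
    | add x y _ _ hx hy =>
      rw [map_add]
      exact padicNorm.nonarchimedean.trans (max_le hx hy)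
    | neg x _ hx => rwa [map_neg, padicNorm.neg]
  have hφg : φ g = 0 := by
    simp only [φ, Finsupp.linearCombination_apply, Finsupp.sum]
    refine Finset.sum_eq_zero fun i hi => ?_
    have : i ∉ T := by
      intro hiT
      rcases i with α | β'
      · obtain ⟨h1, β', h2, h3⟩ := (hTl α).1 hiT
        exact hc1 α (Finsupp.mem_support_iff.1 hi) h1 β' h2 h3
      · obtain ⟨h1, h2⟩ := (hTr β').1 hiT
        exact hc2 β' h1 (Finsupp.mem_support_iff.1 hi) h2
    simp [c, this]
  obtain ⟨w, hw, he⟩ := hd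
  have h1 : (l : ℚ) = (𝒮.p ν n : ℚ) * φ w := by
    have := congrArg φ he
    rw [map_sub, hφg, _root_.sub_zero, map_nsmul, map_nsmul, hφy] at this
    have hT : Sum.inr β ∈ T := (hTr β).2 ⟨hβ, hγ⟩
    simpa [c, hT] using this
  have h2 : padicNorm (𝒮.p ν n) (l : ℚ) = 1 := (padicNorm.nat_eq_one_iff l).2 hl
  rw [h1, padicNorm.mul] at h2
  have h3 := padicNorm.padicNorm_p_lt_one_of_prime (p := 𝒮.p ν n)
  have h4 := hintegral w hw
  have h5 : 0 ≤ padicNorm (𝒮.p ν n) (φ w) := padicNorm.nonneg _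
  have h6 : 0 ≤ padicNorm (𝒮.p ν n) (𝒮.p ν n : ℚ) := padicNorm.nonneg _
  nlinarith

/-- index of a basis element -/
def idx : Ordinal.{0} ⊕ Ordinal.{0} → Ordinal.{0} := Sum.elim id id

theorem final_contra (𝒮 : StarSystem) {β : Ordinal.{0}} (hβ : β ∈ 𝒮.S)
    (hm : ∀ α < β, (∃ β' ∈ 𝒮.S, α ∈ 𝒮.C β') → ∃ β' ∈ 𝒮.S, β' ≠ β ∧ α ∈ 𝒮.C β')
    (A : Set Vg) (hA : A.Countable) (hAβ : ∀ a ∈ A, ∀ i ∈ a.support, idx i < β)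
    (hcov : ∀ α ∈ 𝒮.C β, Cov 𝒮.G (yg β) (fun p => divIn 𝒮.G p (1 • yg β - xg α)) A) : False := by
  classical
  have hEδ : otype (𝒮.E β) = 𝒮.δ := 𝒮.D_type β hβ _ le_rfl (𝒮.C_cofinal β hβ)
  have hEcount : (𝒮.E β).Countable := otype_countable (hEδ ▸ 𝒮.δ_countable)
  have hCne : (𝒮.C β).Nonempty := by
    rw [Set.nonempty_iff_ne_empty]
    intro h
    have h1 := 𝒮.C_cofinal β hβ
    rw [h] at h1
    have h2 := 𝒮.S_cof β hβ
    rw [← h1] at h2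
    simp at h2
    exact absurd h2.symm (Cardinal.aleph_pos 1).ne'
  have hfE : ∀ β', ∀ α ∈ 𝒮.C β', ∀ n, 𝒮.f α n ∈ 𝒮.E β' := by
    intro β' α hα n
    exact Set.mem_biUnion hα ⟨n, rfl⟩
  have h1δ : (1 : Ordinal.{1}) < 𝒮.δ := by
    obtain ⟨α, hα⟩ := hCne
    obtain ⟨β', hβ', hne, hα'⟩ := hm α (𝒮.C_sub β hβ hα) ⟨β, hβ, hα⟩
    rw [← otype_singleton (𝒮.f α 0)]
    refine (otype_mono ?_).trans_lt (𝒮.E_inter β hβ β' hβ' hne.symm)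
    rintro _ rfl
    exact ⟨hfE β α hα 0, hfE β' α hα' 0⟩
  have h0δ : (0 : Ordinal.{1}) < 𝒮.δ := lt_trans zero_lt_one h1δ
  let Bi : Ordinal.{0} ⊕ Ordinal.{0} → Set Ordinal.{0} := Sum.elim
    (fun α => {γ | γ ∈ 𝒮.E β ∧ γ ∈ Set.range (𝒮.f α) ∧ ∃ β' ∈ 𝒮.S, α ∈ 𝒮.C β'})
    (fun β' => {γ | γ ∈ 𝒮.E β ∧ γ ∈ 𝒮.E β' ∧ β' ∈ 𝒮.S})
  have hBi : ∀ i, idx i < β → otype (Bi i) < 𝒮.δ := by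
    rintro (α | β') hi
    · change α < β at hi
      by_cases h : ∃ β' ∈ 𝒮.S, α ∈ 𝒮.C β'
      · obtain ⟨β', hβ', hne, hα'⟩ := hm α hi h
        refine (otype_mono ?_).trans_lt (𝒮.E_inter β hβ β' hβ' hne.symm)
        rintro _ ⟨h1, ⟨n, rfl⟩, -⟩
        exact ⟨h1, hfE β' α hα' n⟩
      · have : Bi (Sum.inl α) = ∅ := by
          ext x
          simp only [Bi, Sum.elim_inl, Set.mem_ofPred_eq, Set.mem_empty_iff_false, iff_false]
          exact fun hx => h hx.2.2
        rw [this, otype_empty]; exact h0δ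
    · change β' < β at hi
      by_cases h : β' ∈ 𝒮.S
      · refine (otype_mono ?_).trans_lt (𝒮.E_inter β hβ β' h hi.ne')
        rintro _ ⟨h1, h2, -⟩
        exact ⟨h1, h2⟩
      · have : Bi (Sum.inr β') = ∅ := by
          ext x
          simp only [Bi, Sum.elim_inr, Set.mem_ofPred_eq, Set.mem_empty_iff_false, iff_false]
          exact fun hx => h hx.2.2
        rw [this, otype_empty]; exact h0δ
  let B : Vg → Set Ordinal.{0} := fun a => ⋃ i ∈ a.support, Bi i
  have hB : ∀ a ∈ A, otype (B a) < 𝒮.δ := fun a ha =>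
    otype_biUnion 𝒮.δ_indec h0δ _ _ fun i hi => hBi i (hAβ a ha i hi)
  let J : Set (Set Vg × Set Ordinal.{0}) :=
    {t | t.Finite ∧ t ⊆ A} ×ˢ {t | t.Finite ∧ t ⊆ 𝒮.E β}
  have hJ : J.Countable :=
    (Set.countable_ofPred_finite_subset hA).prod (Set.countable_ofPred_finite_subset hEcount)
  let Bs : Set Vg × Set Ordinal.{0} → Set Ordinal.{0} := fun j => (⋃ a ∈ j.1, B a) ∪ j.2
  have hBs : ∀ j ∈ J, otype (Bs j) < 𝒮.δ := by
    rintro ⟨s, X⟩ ⟨⟨hs, hsA⟩, hX, hXE⟩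
    refine otype_union 𝒮.δ_indec _ _ ?_ ?_
    · have := otype_biUnion 𝒮.δ_indec h0δ hs.toFinset B fun a ha => hB a (hsA (by simpa using ha))
      simpa using this
    · have := otype_biUnion 𝒮.δ_indec h0δ hX.toFinset (fun c => {c})
        fun c _ => by rw [otype_singleton]; exact h1δ
      simpa using this
  have hex : ∀ α ∈ 𝒮.C β, ∃ j ∈ J, Set.range (𝒮.f α) ⊆ Bs j := by
    intro α hα
    obtain ⟨F, hF, P, hP⟩ := hcov α hα
    let ν : ℕ → Ordinal.{1} := fun n => otype (𝒮.E β ∩ Set.Iio (𝒮.f α n))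
    have hν : ∀ n, ν n < 𝒮.δ := fun n => hEδ ▸ otype_inter_lt (𝒮.E β) (hfE β α hα n)
    have hnth : ∀ n, nthMem (𝒮.E β) (ν n) (𝒮.f α n) := fun n => ⟨hfE β α hα n, rfl⟩
    let P' : Finset ℕ := P ∪ F.biUnion fun x => x.1.primeFactors
    let X : Set ℕ := (fun n => 𝒮.p (ν n) n) ⁻¹' (P' : Set ℕ)
    have hX : X.Finite := by
      refine Set.Finite.preimage ?_ P'.finite_toSet
      intro n _ n' _ h
      exact (𝒮.p_inj _ (hν n) _ (hν n') n n' h).2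
    refine ⟨(Prod.snd '' (F : Set (ℕ × Vg)), 𝒮.f α '' X), ⟨⟨F.finite_toSet.image _, ?_⟩,
      hX.image _, ?_⟩, ?_⟩
    · rintro _ ⟨x, hx, rfl⟩
      exact (hF x hx).2
    · rintro _ ⟨n, -, rfl⟩
      exact hfE β α hα n
    · rintro _ ⟨n, rfl⟩
      by_cases hn : n ∈ X
      · right; exact ⟨n, hn, rfl⟩
      left
      have hn' : 𝒮.p (ν n) n ∉ P' := hn
      simp only [P', Finset.mem_union, Finset.mem_biUnion, not_or, not_exists, not_and] at hn'
      have hp := 𝒮.p_prime (ν n) (hν n) n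
      have hd : divIn 𝒮.G (𝒮.p (ν n) n) (1 • yg β - xg α) := by
        refine ⟨((𝒮.p (ν n) n : ℚ))⁻¹ • (yg β - xg α), AddSubgroup.subset_closure ?_, ?_⟩
        · right
          exact ⟨β, hβ, α, hα, ν n, hν n, n, hnth n, rfl⟩
        · rw [one_smul, ← Nat.cast_smul_eq_nsmul ℚ, smul_smul, mul_inv_cancel₀, one_smul]
          exact_mod_cast hp.ne_zero
      obtain ⟨x, hx, hd'⟩ := hP _ hp hn'.1 hd
      have hndvd : ¬ 𝒮.p (ν n) n ∣ x.1 := fun h =>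
        hn'.2 x hx (Nat.mem_primeFactors.2 ⟨hp, h, (hF x hx).1.ne'⟩)
      have hxβ : x.2 (Sum.inr β) = 0 := by
        by_contra h
        exact lt_irrefl β (hAβ x.2 (hF x hx).2 (Sum.inr β) (Finsupp.mem_support_iff.2 h))
      refine Set.mem_biUnion (x := x.2) ⟨x, hx, rfl⟩ ?_
      rcases div_cases 𝒮 hβ (hν n) (hnth n) hndvd hxβ hd' with
        ⟨α', h1, h2, h3⟩ | ⟨β', h1, h2, h3⟩
      · exact Set.mem_biUnion (x := Sum.inl α') (Finsupp.mem_support_iff.2 h1)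
          ⟨hfE β α hα n, ⟨n, h2⟩, h3⟩
      · exact Set.mem_biUnion (x := Sum.inr β') (Finsupp.mem_support_iff.2 h2)
          ⟨hfE β α hα n, h3.1, h1⟩
  choose! j hj1 hj2 using hex
  let D : Set Vg × Set Ordinal.{0} → Set Ordinal.{0} := fun t => {α ∈ 𝒮.C β | j α = t}
  have hDC : ∀ t, D t ⊆ 𝒮.C β := fun t α h => h.1
  have hbdd : ∀ t, BddAbove (D t) := fun t => ⟨β, fun α h => (𝒮.C_sub β hβ (hDC t h)).le⟩
  have hD : ∀ t ∈ J, sSup (D t) < β := by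
    intro t ht
    refine lt_of_le_of_ne ?_ ?_
    · rcases (D t).eq_empty_or_nonempty with h | h
      · rw [h]; simp
      · exact csSup_le h fun α h => (𝒮.C_sub β hβ (hDC t h)).le
    · intro heq
      have h1 := 𝒮.D_type β hβ (D t) (hDC t) heq
      have h2 : otype (⋃ α ∈ D t, Set.range (𝒮.f α)) ≤ otype (Bs t) := by
        refine otype_mono (Set.iUnion₂_subset ?_)
        rintro α ⟨hα, rfl⟩
        exact hj2 α hα
      exact absurd (h2.trans_lt (hBs t ht)) (by rw [h1]; exact lt_irrefl _)
  have hs : sSup ((fun t => sSup (D t)) '' J) < β := by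
    refine Ordinal.sSup_lt_of_lt_cof ?_ ?_
    · refine lt_of_le_of_lt ((Cardinal.le_aleph0_iff_set_countable).2 (hJ.image _)) ?_
      rw [← Ordinal.lift_cof, 𝒮.S_cof β hβ, Cardinal.lift_aleph]
      simpa using Cardinal.aleph0_lt_aleph_one
    · rintro _ ⟨t, ht, rfl⟩
      exact hD t ht
  have hle : sSup (𝒮.C β) ≤ sSup ((fun t => sSup (D t)) '' J) := by
    refine csSup_le hCne fun α hα => ?_
    refine (le_csSup (hbdd (j α)) ⟨hα, rfl⟩).trans ?_
    refine le_csSup ⟨β, ?_⟩ ⟨j α, hj1 α hα, rfl⟩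
    rintro _ ⟨t, ht, rfl⟩
    exact (hD t ht).le
  rw [𝒮.C_cofinal β hβ] at hle
  exact absurd hs (not_lt.2 hle)

end Star
section Club

/-- The ordinal `λ = ℵ_{ω+1}`. -/
noncomputable abbrev lamO : Ordinal.{0} := (Cardinal.aleph (Ordinal.omega0 + 1)).ord

theorem lam_cof : (Ordinal.lift.{1} lamO).cof = Cardinal.aleph.{1} (Ordinal.omega0 + 1) := by
  rw [← Ordinal.lift_cof]
  have h := (Cardinal.isRegular_aleph_add_one Ordinal.omega0.{0}).cof_ord
  rw [h, Cardinal.lift_aleph]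
  simp

theorem mk_Iio_lam : #(Set.Iio lamO) = Cardinal.aleph.{1} (Ordinal.omega0 + 1) := by
  rw [Cardinal.mk_Iio_ordinal, Cardinal.card_ord, Cardinal.lift_aleph]
  simp

theorem mk_Iio_lt {γ : Ordinal.{0}} (h : γ < lamO) :
    #(Set.Iio γ) < Cardinal.aleph.{1} (Ordinal.omega0 + 1) := by
  rw [Cardinal.mk_Iio_ordinal]
  have h1 := Cardinal.lift_lt.{0, 1}.2 (Cardinal.lt_ord.1 h)
  rw [Cardinal.lift_aleph] at h1
  simpa using h1

theorem aleph0_lt_lam : ℵ₀ < Cardinal.aleph.{1} (Ordinal.omega0 + 1) := by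
  rw [← Cardinal.aleph_zero]
  exact Cardinal.aleph_lt_aleph.2 (by simp)

/-- vectors supported on indices `< γ` -/
def suppBelow (γ : Ordinal.{0}) : Set Vg := {v | ∀ i ∈ v.support, idx i < γ}

theorem mk_suppBelow (γ : Ordinal.{0}) :
    #(suppBelow γ) ≤ max (#(Set.Iio γ) + #(Set.Iio γ)) ℵ₀ := by
  let I : Set (Ordinal.{0} ⊕ Ordinal.{0}) := {i | idx i < γ}
  have hI : #I ≤ #(Set.Iio γ) + #(Set.Iio γ) := by
    have h1 : I ⊆ Sum.inl '' Set.Iio γ ∪ Sum.inr '' Set.Iio γ := by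
      rintro (α | α) h
      · exact Or.inl ⟨α, h, rfl⟩
      · exact Or.inr ⟨α, h, rfl⟩
    refine (Cardinal.mk_le_mk_of_subset h1).trans ((Cardinal.mk_union_le _ _).trans ?_)
    exact add_le_add Cardinal.mk_image_le Cardinal.mk_image_le
  have h2 : #(suppBelow γ) ≤ #(I →₀ ℚ) := by
    have e := (Finsupp.supportedEquivFinsupp (M := ℚ) (R := ℚ) I).toEquiv
    rw [← Cardinal.mk_congr e]
    refine Cardinal.mk_le_mk_of_subset ?_
    intro v hv
    exact (Finsupp.mem_supported ℚ v).2 fun i hi => hv i hi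
  refine h2.trans ?_
  rcases isEmpty_or_nonempty I with h | h
  · rw [Cardinal.mk_eq_one]
    exact le_max_of_le_right Cardinal.one_le_aleph0
  · rw [Cardinal.mk_finsupp_lift_of_infinite']
    simp only [Cardinal.lift_id', Cardinal.mk_eq_aleph0, Cardinal.lift_aleph0, Cardinal.lift_uzero]
    exact max_le_max hI le_rfl

theorem G_supp (𝒮 : StarSystem) : ∀ v ∈ 𝒮.G, v ∈ suppBelow lamO := by
  classical
  have hx : ∀ α < lamO, xg α ∈ suppBelow lamO := by
    intro α hα i hi
    have := Finsupp.support_single_subset hi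
    rw [Finset.mem_singleton] at this
    subst this; exact hα
  have hy : ∀ α < lamO, yg α ∈ suppBelow lamO := by
    intro α hα i hi
    have := Finsupp.support_single_subset hi
    rw [Finset.mem_singleton] at this
    subst this; exact hα
  have hsub : ∀ u v, u ∈ suppBelow lamO → v ∈ suppBelow lamO → u - v ∈ suppBelow lamO := by
    intro u v hu hv i hi
    rcases Finset.mem_union.1 (Finsupp.support_sub hi) with h | h
    · exact hu i h
    · exact hv i h
  intro v hv
  induction hv using AddSubgroup.closure_induction with
  | mem w hw =>
    rcases hw with (⟨α, h, rfl⟩ | ⟨β', h, rfl⟩) | ⟨β', hβ', α, hα, ν', hν', n', hnth, rfl⟩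
    · exact hx α h
    · exact hy _ (𝒮.S_sub h)
    · intro i hi
      exact hsub _ _ (hy _ (𝒮.S_sub hβ')) (hx α ((𝒮.C_sub _ hβ' hα).trans (𝒮.S_sub hβ'))) i
        (Finsupp.support_smul hi)
  | zero => intro i hi; simp at hi
  | add x y _ _ hx hy =>
    intro i hi
    rcases Finset.mem_union.1 (Finsupp.support_add hi) with h | h
    · exact hx i h
    · exact hy i h
  | neg x _ hx => intro i hi; rw [Finsupp.support_neg] at hi; exact hx i hi

theorem mk_G (𝒮 : StarSystem) : #↥𝒮.G = Cardinal.aleph (Ordinal.omega0 + 1) := by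
  apply le_antisymm
  · have h1 : #↥𝒮.G ≤ #(suppBelow lamO) :=
      Cardinal.mk_le_mk_of_subset (s := (𝒮.G : Set Vg)) fun v hv => G_supp 𝒮 v hv
    refine h1.trans ((mk_suppBelow _).trans ?_)
    rw [mk_Iio_lam, Cardinal.add_eq_self aleph0_lt_lam.le]
    exact max_le le_rfl aleph0_lt_lam.le
  · rw [← mk_Iio_lam]
    refine Cardinal.mk_le_of_injective (f := fun α : Set.Iio lamO =>
      (⟨xg α.1, AddSubgroup.subset_closure (Or.inl (Or.inl ⟨α.1, α.2, rfl⟩))⟩ : 𝒮.G)) ?_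
    intro a b h
    have h1 : xg a.1 = xg b.1 := congrArg Subtype.val h
    have h2 := Finsupp.single_left_injective (one_ne_zero (α := ℚ)) h1
    exact Subtype.ext (Sum.inl_injective h2)

theorem exists_club (g : Vg → ℕ → Vg) (hg : ∀ z n, g z n ∈ suppBelow lamO)
    (m : Ordinal.{0} → Ordinal.{0}) (hm : ∀ α, m α < lamO) :
    ∃ C : Set Ordinal.{0}, IsClubIn C lamO ∧ ∀ γ ∈ C,
      (∀ α < γ, m α < γ) ∧ ∀ γ' < γ, ∀ z ∈ suppBelow γ', ∀ n, g z n ∈ suppBelow γ := by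
  let R : Ordinal.{0} → Set Ordinal.{0} := fun γ =>
    (Set.Iio γ ∪ {γ}) ∪ m '' (Set.Iio γ ∪ {γ}) ∪
      ⋃ z : suppBelow γ, ⋃ n : ℕ, idx '' ((g z.1 n).support : Set (Ordinal.{0} ⊕ Ordinal.{0}))
  let s : Ordinal.{0} → Ordinal.{0} := fun γ => sSup (R γ) + 1
  have hRlam : ∀ γ < lamO, ∀ x ∈ R γ, x < lamO := by
    rintro γ hγ x ((h | ⟨a, -, rfl⟩) | h)
    · rcases h with h | h
      · exact lt_trans h hγ
      · rw [Set.mem_singleton_iff] at h; subst h; exact hγ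
    · exact hm a
    · simp only [Set.mem_iUnion] at h
      obtain ⟨z, n, i, hi, rfl⟩ := h
      exact hg z.1 n i hi
  have hbdd : ∀ γ < lamO, BddAbove (R γ) := fun γ hγ => ⟨lamO, fun x hx => (hRlam γ hγ x hx).le⟩
  have hlt : ∀ γ < lamO, ∀ x ∈ R γ, x < s γ := fun γ hγ x hx =>
    Order.lt_add_one_iff.2 (le_csSup (hbdd γ hγ) hx)
  have hself : ∀ γ, γ ∈ R γ := fun γ => Or.inl (Or.inl (Or.inr rfl))
  have hIic : ∀ {γ γ' : Ordinal.{0}}, γ ≤ γ' →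
      (Set.Iio γ ∪ {γ} : Set Ordinal.{0}) ⊆ Set.Iio γ' ∪ {γ'} := by
    rintro γ γ' h x (hx | hx)
    · exact Or.inl (lt_of_lt_of_le hx h)
    · rw [Set.mem_singleton_iff] at hx; subst hx
      rcases h.lt_or_eq with h | h
      · exact Or.inl h
      · exact Or.inr h
  have hRmono : ∀ {γ γ' : Ordinal.{0}}, γ ≤ γ' → R γ ⊆ R γ' := by
    intro γ γ' h
    refine Set.union_subset_union (Set.union_subset_union (hIic h) (Set.image_mono (hIic h))) ?_
    intro x hx
    simp only [Set.mem_iUnion] at hx ⊢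
    obtain ⟨z, hz⟩ := hx
    exact ⟨⟨z.1, fun i hi => (z.2 i hi).trans_le h⟩, hz⟩
  have hsmono : ∀ {γ γ' : Ordinal.{0}}, γ ≤ γ' → γ' < lamO → s γ ≤ s γ' := by
    intro γ γ' h h'
    have : sSup (R γ) ≤ sSup (R γ') := csSup_le_csSup (hbdd γ' h') ⟨γ, hself γ⟩ (hRmono h)
    exact add_le_add_left this 1
  have hlamlim : Order.IsSuccLimit lamO :=
    Cardinal.isSuccLimit_ord (Cardinal.aleph0_le_aleph _)
  have hslam : ∀ γ < lamO, s γ < lamO := by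
    intro γ hγ
    refine hlamlim.add_one_lt ?_
    refine Ordinal.sSup_lt_of_lt_cof ?_ (hRlam γ hγ)
    rw [lam_cof]
    have hinf := aleph0_lt_lam.le
    have h1 : #(Set.Iio γ ∪ {γ} : Set Ordinal.{0}) < Cardinal.aleph.{1} (Ordinal.omega0 + 1) := by
      refine (Cardinal.mk_union_le _ _).trans_lt (Cardinal.add_lt_of_lt hinf (mk_Iio_lt hγ) ?_)
      rw [Cardinal.mk_singleton]
      exact Cardinal.one_lt_aleph0.trans aleph0_lt_lam
    have h2 : #(suppBelow γ) < Cardinal.aleph.{1} (Ordinal.omega0 + 1) :=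
      (mk_suppBelow γ).trans_lt (max_lt
        (Cardinal.add_lt_of_lt hinf (mk_Iio_lt hγ) (mk_Iio_lt hγ)) aleph0_lt_lam)
    refine (Cardinal.mk_union_le _ _).trans_lt (Cardinal.add_lt_of_lt hinf
      ((Cardinal.mk_union_le _ _).trans_lt
        (Cardinal.add_lt_of_lt hinf h1 (Cardinal.mk_image_le.trans_lt h1))) ?_)
    refine (Cardinal.mk_iUnion_le _).trans_lt (Cardinal.mul_lt_of_lt hinf h2 ?_)
    refine lt_of_le_of_lt (ciSup_le' fun z => ?_) aleph0_lt_lam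
    refine Cardinal.le_aleph0_iff_set_countable.2 (Set.countable_iUnion fun n => ?_)
    exact ((Finset.countable_toSet _).image _)
  refine ⟨{γ | γ < lamO ∧ ∀ γ' < γ, s γ' < γ}, ⟨fun γ h => h.1, ?_, ?_⟩, ?_⟩
  · intro a ha
    have hb : ∀ n : ℕ, s^[n] a < lamO := by
      intro n
      induction n with
      | zero => exact ha
      | succ n ih => rw [Function.iterate_succ_apply']; exact hslam _ ih
    have hbd : BddAbove (Set.range fun n : ℕ => s^[n] a) :=
      ⟨lamO, by rintro _ ⟨n, rfl⟩; exact (hb n).le⟩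
    have hsup : (⨆ n : ℕ, s^[n] a) < lamO := by
      refine Ordinal.sSup_lt_of_lt_cof ?_ ?_
      · rw [lam_cof]
        exact (Cardinal.le_aleph0_iff_set_countable.2 (Set.countable_range _)).trans_lt aleph0_lt_lam
      · rintro _ ⟨n, rfl⟩; exact hb n
    refine ⟨⨆ n : ℕ, s^[n] a, ⟨hsup, ?_⟩, le_ciSup hbd 0⟩
    intro γ' hγ'
    obtain ⟨n, hn⟩ := exists_lt_of_lt_ciSup hγ'
    have h1 : s γ' ≤ s^[n + 1] a := by
      rw [Function.iterate_succ_apply']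
      exact hsmono hn.le (hb n)
    have h2 : s^[n + 1] a < s^[n + 2] a := by
      rw [Function.iterate_succ_apply' s (n + 1)]
      exact hlt _ (hb _) _ (hself _)
    exact h1.trans_lt (h2.trans_le (le_ciSup hbd (n + 2)))
  · intro t ht hne hlt'
    refine ⟨hlt', fun γ' hγ' => ?_⟩
    obtain ⟨c, hc, h⟩ := exists_lt_of_lt_csSup hne hγ'
    exact ((ht hc).2 γ' h).trans_le (le_csSup ⟨lamO, fun x hx => (ht hx).1.le⟩ hc)
  · rintro γ ⟨hγ, hcl⟩
    refine ⟨fun α hα => ?_, fun γ' hγ' z hz n i hi => ?_⟩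
    · exact (hlt α (hα.trans hγ) _ (Or.inl (Or.inr ⟨α, Or.inr rfl, rfl⟩))).trans (hcl α hα)
    · refine (hlt γ' (hγ'.trans hγ) _ (Or.inr ?_)).trans (hcl γ' hγ')
      simp only [Set.mem_iUnion]
      exact ⟨⟨z, hz⟩, n, i, hi, rfl⟩

/-- The subgroup of elements of `G` supported below `γ`. -/
def Ksub (G : AddSubgroup Vg) (γ : Ordinal.{0}) : AddSubgroup Vg where
  carrier := {v | v ∈ G ∧ v ∈ suppBelow γ}
  add_mem' := by
    classical
    rintro x y ⟨hx, hx'⟩ ⟨hy, hy'⟩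
    refine ⟨G.add_mem hx hy, fun i hi => ?_⟩
    rcases Finset.mem_union.1 (Finsupp.support_add hi) with h | h
    · exact hx' i h
    · exact hy' i h
  zero_mem' := ⟨G.zero_mem, fun i hi => by simp at hi⟩
  neg_mem' := by
    rintro x ⟨hx, hx'⟩
    exact ⟨G.neg_mem hx, fun i hi => by rw [Finsupp.support_neg] at hi; exact hx' i hi⟩

theorem no_chain (𝒮 : StarSystem) (θ : Ordinal.{1}) (H : Ordinal.{1} → AddSubgroup Vg)
    (hG : ∀ ν ≤ θ, H ν ≤ 𝒮.G)
    (hmono : ∀ ν₁ : Ordinal.{1}, ∀ ν₂ ≤ θ, ν₁ ≤ ν₂ → H ν₁ ≤ H ν₂)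
    (hlim : ∀ ρ ≤ θ, Order.IsSuccLimit ρ → ∀ v : Vg, (v ∈ H ρ ↔ ∃ ν < ρ, v ∈ H ν))
    (h0 : H 0 = ⊥) (hθ : H θ = 𝒮.G)
    (hpb : ∀ ν ≤ θ, IsPureIn (H ν) 𝒮.G ∧ Aleph0Prebalanced (H ν) 𝒮.G)
    (hrk : ∀ ν < θ, Module.rank ℚ
          (ℚ ⊗[ℤ] (↥(H (ν + 1)) ⧸ (H ν).addSubgroupOf (H (ν + 1)))) ≤ 1) : False := by
  classical
  have hrank : ∀ z ∈ 𝒮.G, z ≠ 0 → ∃ ρ < θ, z ∈ H (ρ + 1) ∧ z ∉ H ρ := by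
    intro z hz hz0
    have key : ∀ ν ≤ θ, z ∈ H ν → ∃ ρ < θ, z ∈ H (ρ + 1) ∧ z ∉ H ρ := by
      intro ν
      induction ν using Ordinal.limitRecOn with
      | zero =>
        intro _ h
        rw [h0, AddSubgroup.mem_bot] at h
        exact absurd h hz0
      | add_one μ ih =>
        intro hle h
        have hμθ : μ < θ := (Order.lt_add_one_iff.2 le_rfl).trans_le hle
        by_cases h' : z ∈ H μ
        · exact ih hμθ.le h'
        · exact ⟨μ, hμθ, h, h'⟩
      | limit ρ hρ ih =>
        intro hle h
        obtain ⟨ν, hν, h'⟩ := (hlim ρ hle hρ z).1 h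
        exact ih ν hν (hν.le.trans hle) h'
    exact key θ le_rfl (hθ ▸ hz)
  have hex : ∀ z : Vg, ∃ (ρ : Ordinal.{1}) (g : ℕ → Vg), (∀ i, g i ∈ 𝒮.G) ∧
      (z ∈ 𝒮.G → z ≠ 0 → ρ < θ ∧ z ∈ H (ρ + 1) ∧ z ∉ H ρ ∧ (∀ i, g i ∈ H ρ) ∧
        ∀ w ∈ H ρ, ∃ l : ℕ, 0 < l ∧ ∃ e : ℕ, typeLe 𝒮.G (z - w) e (fun i => l • z - g i)) := by
    intro z
    by_cases h : z ∈ 𝒮.G ∧ z ≠ 0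
    · obtain ⟨ρ, hρ, h1, h2⟩ := hrank z h.1 h.2
      obtain ⟨g, hg1, hg2⟩ := (hpb ρ hρ.le).2 z h.1 h2
      exact ⟨ρ, g, fun i => hG ρ hρ.le (hg1 i), fun _ _ => ⟨hρ, h1, h2, hg1, hg2⟩⟩
    · exact ⟨0, fun _ => 0, fun _ => 𝒮.G.zero_mem, fun h1 h2 => absurd ⟨h1, h2⟩ h⟩
  choose rk g hgG hgr using hex
  have hmex : ∀ α : Ordinal.{0}, ∃ b < lamO, (∃ β' ∈ 𝒮.S, α ∈ 𝒮.C β') → b ∈ 𝒮.S ∧ α ∈ 𝒮.C b := by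
    intro α
    by_cases h : ∃ β' ∈ 𝒮.S, α ∈ 𝒮.C β'
    · obtain ⟨β', h1, h2⟩ := h
      exact ⟨β', 𝒮.S_sub h1, fun _ => ⟨h1, h2⟩⟩
    · refine ⟨0, ?_, fun h' => absurd h' h⟩
      exact Cardinal.ord_pos.2 (Cardinal.aleph_pos _)
  choose m hm1 hm2 using hmex
  obtain ⟨Cl, hCl, hCl'⟩ := exists_club g (fun z n => G_supp 𝒮 _ (hgG z n)) m hm1
  obtain ⟨β, hβ, hβC⟩ := 𝒮.S_stat.2 Cl hCl
  obtain ⟨hcm, hcg⟩ := hCl' β hβC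
  have hβlim : Order.IsSuccLimit β := by
    rw [← Ordinal.one_lt_cof_iff, 𝒮.S_cof β hβ]
    exact Cardinal.one_lt_aleph0.trans Cardinal.aleph0_lt_aleph_one
  have hβ0 : (⊥ : Ordinal.{0}) < β := hβlim.bot_lt
  have hgood : GoodFor 𝒮.G (Ksub 𝒮.G β) (yg β) := by
    refine chain_good 𝒮.G (Ksub 𝒮.G β) θ H hG hmono hlim h0 hpb hrk rk g ?_ θ le_rfl (yg β) ?_
    · rintro z ⟨hzG, hz⟩ hz0
      obtain ⟨h1, h2, h3, h4, h5⟩ := hgr z hzG hz0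
      refine ⟨h1, h2, h3, h4, fun i => ⟨hgG z i, ?_⟩, h5⟩
      refine hcg (z.support.sup fun i => idx i + 1) ?_ z ?_ i
      · rw [Finset.sup_lt_iff hβ0]
        exact fun i hi => hβlim.add_one_lt (hz i hi)
      · intro i hi
        exact Order.add_one_le_iff.1 (Finset.le_sup (f := fun i => idx i + 1) hi)
    · rw [hθ]
      exact AddSubgroup.subset_closure (Or.inl (Or.inr ⟨β, hβ, rfl⟩))
  obtain ⟨A, hA, hAK, hcov⟩ := hgood
  refine final_contra 𝒮 hβ ?_ A hA (fun a ha => (hAK ha).2) ?_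
  · intro α hα h
    exact ⟨m α, (hm2 α h).1, (hcm α hα).ne, (hm2 α h).2⟩
  · intro α hα
    have hαβ : α < β := 𝒮.C_sub β hβ hα
    refine hcov (xg α) ⟨?_, ?_⟩ 1 one_pos
    · exact AddSubgroup.subset_closure (Or.inl (Or.inl ⟨α, hαβ.trans (𝒮.S_sub hβ), rfl⟩))
    · intro i hi
      have := Finsupp.support_single_subset hi
      rw [Finset.mem_singleton] at this
      subst this; exact hαβ

end Club

/-- **The main theorem (Theorem 3 of Magidor–Shelah).**
Assume (*).  Then the torsion-free group `G`, which has cardinality `ℵ_{ω+1}`,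
does not admit an `ℵ₀`-prebalanced chain: there is no ordinal `θ` and no
increasing chain `⟨H_ν : ν ≤ θ⟩` of subgroups of `G`, continuous at limit
stages, with `H_0 = 0` and `H_θ = G`, such that each `H_ν` is pure and
`ℵ₀`-prebalanced in `G` and each successor quotient `H_{ν+1}/H_ν` has
torsion-free rank at most `1`. -/
theorem G_admits_no_aleph0_prebalanced_chain (𝒮 : StarSystem) :
    (∀ v ∈ 𝒮.G, ∀ n : ℕ, n ≠ 0 → n • v = 0 → v = 0) ∧
    #↥𝒮.G = Cardinal.aleph (Ordinal.omega0 + 1) ∧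
    ¬ ∃ (θ : Ordinal.{1}) (H : Ordinal.{1} → AddSubgroup Vg),
        (∀ ν ≤ θ, H ν ≤ 𝒮.G) ∧
        (∀ ν₁ : Ordinal.{1}, ∀ ν₂ ≤ θ, ν₁ ≤ ν₂ → H ν₁ ≤ H ν₂) ∧
        (∀ ρ ≤ θ, Order.IsSuccLimit ρ → ∀ v : Vg, (v ∈ H ρ ↔ ∃ ν < ρ, v ∈ H ν)) ∧
        H 0 = ⊥ ∧ H θ = 𝒮.G ∧
        (∀ ν ≤ θ, IsPureIn (H ν) 𝒮.G ∧ Aleph0Prebalanced (H ν) 𝒮.G) ∧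
        (∀ ν < θ, Module.rank ℚ
          (ℚ ⊗[ℤ] (↥(H (ν + 1)) ⧸ (H ν).addSubgroupOf (H (ν + 1)))) ≤ 1) := by
  refine ⟨?_, mk_G 𝒮, ?_⟩
  · intro v _ n hn h
    exact (smul_eq_zero.1 h).resolve_left hn
  · rintro ⟨θ, H, hG, hmono, hlim, h0, hθ, hpb, hrk⟩
    exact no_chain 𝒮 θ H hG hmono hlim h0 hθ hpb hrk
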